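/- arXiv:1804.00940 — 2 statements merged into one kernel-verified Lean document; each statement's English description precedes it below -/
import Mathlib

section
/- Let A be a Noetherian ring, M a finitely generated A-module contained in a free A-module F of finite rank r > 0, and N an A-submodule of F with M ⊆ N. If M^ℓ = N^ℓ for some ℓ > 0, then M^n = N^n for every n ≥ ℓ, where the powers are computed inside S = Sym_A(F). -/
set_option maxHeartbeats 1000000
set_option synthInstance.maxHeartbeats 400000

open MvPolynomial IsLocalRing

/-- The embedding of the free module `A^r` onto the degree-one part of the
polynomial ring `Sym_A(A^r) = A[t_1, ..., t_r]`, sending `f` to `∑ i, f i • X i`. -/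
noncomputable abbrev emb (A : Type) [CommRing A] (r : ℕ) :
    (Fin r → A) →ₗ[A] MvPolynomial (Fin r) A :=
  Fintype.linearCombination A MvPolynomial.X

/-- The image `F₁` of the free module `F = A^r` inside `S = Sym_A(F)`. -/
noncomputable def freeSub (A : Type) [CommRing A] (r : ℕ) :
    Submodule A (MvPolynomial (Fin r) A) :=
  Submodule.map (emb A r) ⊤

/-- The image `M₁` of a submodule `M ⊆ F` inside `S = Sym_A(F)`. -/
noncomputable def sub1 (A : Type) [CommRing A] (r : ℕ) (M : Submodule A (Fin r → A)) :
    Submodule A (MvPolynomial (Fin r) A) :=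
  M.map (emb A r)

/-- The Rees algebra `R(M)` of `M ⊆ F`, i.e. the `A`-subalgebra of `S = Sym_A(F)`
generated by the degree-one part `M₁`; its `n`-th homogeneous component is `M₁ ^ n`. -/
noncomputable abbrev reesAlg (A : Type) [CommRing A] (r : ℕ) (M : Submodule A (Fin r → A)) :
    Subalgebra A (MvPolynomial (Fin r) A) :=
  Algebra.adjoin A (sub1 A r M : Set (MvPolynomial (Fin r) A))

/-- The Ratliff--Rush closure `⋃_{ℓ > 0} [N^{ℓ+1} :_{Fn} N^ℓ]` of `N` (inside `Fn`),
where all powers and quotients of submodules are taken inside `S = Sym_A(F)`. -/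
noncomputable def ratliffRush (A : Type) [CommRing A] (r : ℕ)
    (Fn N : Submodule A (MvPolynomial (Fin r) A)) : Submodule A (MvPolynomial (Fin r) A) :=
  ⨆ ℓ : ℕ, (Fn ⊓ (N ^ (ℓ + 2) / N ^ (ℓ + 1)))

/-- The positive part `R₊ = ker(constant term)` of a graded subalgebra `R₀ ⊆ S`. -/
noncomputable def posPart (A : Type) [CommRing A] (r : ℕ)
    (R0 : Subalgebra A (MvPolynomial (Fin r) A)) : Ideal ↥R0 :=
  RingHom.ker ((MvPolynomial.constantCoeff).comp R0.val.toRingHom)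

/-- `widetilde{R₀} = ε⁻¹(H⁰_{R₀₊}(S/R₀))`, i.e., the set of `x ∈ S` annihilated into `R₀`
by a power of the irrelevant ideal `R₀₊`; a graded subring of `S` containing `R₀`. -/
noncomputable def rrAlg (A : Type) [CommRing A] (r : ℕ)
    (R0 : Subalgebra A (MvPolynomial (Fin r) A)) : Subalgebra A (MvPolynomial (Fin r) A) where
  carrier := {x | ∃ m : ℕ, ∀ y ∈ (posPart A r R0) ^ m,
    (y : MvPolynomial (Fin r) A) * x ∈ R0}
  mul_mem' := by
    rintro x₁ x₂ ⟨m₁, h₁⟩ ⟨m₂, h₂⟩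
    refine ⟨m₁ + m₂, fun y hy => ?_⟩
    rw [pow_add] at hy
    refine Submodule.mul_induction_on hy (fun p hp q hq => ?_) (fun a b ha hb => ?_)
    · have : ((p * q : ↥R0) : MvPolynomial (Fin r) A) * (x₁ * x₂)
          = ((p : MvPolynomial (Fin r) A) * x₁) * ((q : MvPolynomial (Fin r) A) * x₂) := by
        push_cast; ring
      rw [this]
      exact mul_mem (h₁ p hp) (h₂ q hq)
    · have : ((a + b : ↥R0) : MvPolynomial (Fin r) A) * (x₁ * x₂)
          = (a : MvPolynomial (Fin r) A) * (x₁ * x₂)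
            + (b : MvPolynomial (Fin r) A) * (x₁ * x₂) := by
        push_cast; ring
      rw [this]
      exact add_mem ha hb
  one_mem' := ⟨0, fun y _ => by rw [mul_one]; exact y.2⟩
  add_mem' := by
    rintro x₁ x₂ ⟨m₁, h₁⟩ ⟨m₂, h₂⟩
    refine ⟨m₁ + m₂, fun y hy => ?_⟩
    rw [mul_add]
    exact add_mem (h₁ y (Ideal.pow_le_pow_right (Nat.le_add_right _ _) hy))
      (h₂ y (Ideal.pow_le_pow_right (Nat.le_add_left _ _) hy))
  zero_mem' := ⟨0, fun y _ => by simpa using R0.zero_mem⟩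
  algebraMap_mem' := fun a =>
    ⟨0, fun y _ => mul_mem y.2 (R0.algebraMap_mem a)⟩

/-- The integral closure of the Rees algebra `R(M)` inside `S = Sym_A(F)`,
viewed as an `A`-subalgebra of `S`. -/
noncomputable def intClAlg (A : Type) [CommRing A] (r : ℕ) (M : Submodule A (Fin r → A)) :
    Subalgebra A (MvPolynomial (Fin r) A) :=
  (integralClosure (↥(reesAlg A r M)) (MvPolynomial (Fin r) A)).restrictScalars A

/-- The integral closure `overline{M^n}`: the `n`-th homogeneous component of the
integral closure of `R(M)` in `S`. -/
noncomputable def barPow (A : Type) [CommRing A] (r : ℕ) (M : Submodule A (Fin r → A))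
    (n : ℕ) : Submodule A (MvPolynomial (Fin r) A) :=
  (freeSub A r) ^ n ⊓ (Subalgebra.toSubmodule (intClAlg A r M))

/-- `M` is a faithful `A`-module. -/
def faithfulSub (A : Type) [CommRing A] (r : ℕ) (M : Submodule A (Fin r → A)) : Prop :=
  ∀ a : A, (∀ x ∈ M, a • x = (0 : Fin r → A)) → a = 0

/-- The length of an `A`-module, as the Krull dimension of its lattice of submodules. -/
noncomputable def modLength (A : Type) [CommRing A] (N : Type) [AddCommGroup N]
    [Module A N] : WithBot ℕ∞ :=
  Order.krullDim (Submodule A N)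

/-- The quotient module `P/N` of two submodules of `S`. -/
abbrev quotNP (A : Type) [CommRing A] (r : ℕ)
    (N P : Submodule A (MvPolynomial (Fin r) A)) :=
  ↥P ⧸ (N.comap P.subtype)

/-- The minimal number of generators of a submodule. -/
noncomputable def minGen (A : Type) [CommRing A] {V : Type} [AddCommGroup V] [Module A V]
    (N : Submodule A V) : ℕ :=
  sInf {n : ℕ | ∃ f : Fin n → V, Submodule.span A (Set.range f) = N}

/-- A Noetherian local ring is Cohen--Macaulay if its depth equals its Krull dimension,
i.e. there is a regular sequence in the maximal ideal whose length is the dimension. -/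
def IsCohenMacaulayLocalRing (R : Type) [CommRing R] [IsLocalRing R] : Prop :=
  ∃ rs : List R, (∀ x ∈ rs, x ∈ maximalIdeal R) ∧
    RingTheory.Sequence.IsRegular R rs ∧ (rs.length : WithBot ℕ∞) = ringKrullDim R

/-- A Noetherian local ring is Buchsbaum (in the sense of Stückrad--Vogel) if every
system of parameters `x_1, …, x_d` is a weak sequence:
`(x_1, …, x_{i-1}) : x_i ⊆ (x_1, …, x_{i-1}) : 𝔪` for all `i`. -/
def IsBuchsbaumLocalRing (R : Type) [CommRing R] [IsLocalRing R] : Prop :=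
  ∀ d : ℕ, ringKrullDim R = d →
    ∀ x : Fin d → R, (∀ i, x i ∈ maximalIdeal R) →
      maximalIdeal R ≤ (Ideal.span (Set.range x)).radical →
      ∀ i : Fin d,
        (Ideal.span (x '' {j | j < i})).colon (Ideal.span {x i}) ≤
          (Ideal.span (x '' {j | j < i})).colon (maximalIdeal R)

/-- An ideal `P` of a graded subalgebra `R₀ ⊆ S` is graded (homogeneous) if it contains,
together with any element, all of its homogeneous components. -/
def IsGradedIdeal (A : Type) [CommRing A] (r : ℕ)
    (R0 : Subalgebra A (MvPolynomial (Fin r) A)) (P : Ideal ↥R0) : Prop :=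
  ∀ x : ↥R0, x ∈ P → ∀ n : ℕ,
    ∀ h : MvPolynomial.homogeneousComponent n (x : MvPolynomial (Fin r) A) ∈ R0,
      (⟨_, h⟩ : ↥R0) ∈ P

/-- The graded maximal ideal `𝔐 = 𝔪 R(M) + R(M)₊` of the Rees algebra, i.e. the
preimage of the maximal ideal under the degree-zero projection. -/
noncomputable abbrev gradedMax (A : Type) [CommRing A] [IsLocalRing A] (r : ℕ)
    (M : Submodule A (Fin r → A)) : Ideal ↥(reesAlg A r M) :=
  Ideal.comap ((MvPolynomial.constantCoeff).comp (reesAlg A r M).val.toRingHom)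
    (maximalIdeal A)


/-- Remark 3.16 / Shimoda's remark. Let `A` be a Noetherian ring, `M`
a finitely generated `A`-module contained in a free module `F` of finite rank `r > 0`,
and `N` an `A`-submodule of `F` with `M ⊆ N`. If `M^ℓ = N^ℓ` for some `ℓ > 0`, then
`M^n = N^n` for every `n ≥ ℓ`, where powers are computed inside `S = Sym_A(F)`. -/
theorem ratliffRush_statement_12 (A : Type) [CommRing A] [IsNoetherianRing A]
    (r : ℕ) (hr : 0 < r) (M N : Submodule A (Fin r → A)) (hMN : M ≤ N)
    (ℓ : ℕ) (hl : 0 < ℓ) (h : (sub1 A r M) ^ ℓ = (sub1 A r N) ^ ℓ) :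
    ∀ n : ℕ, ℓ ≤ n → (sub1 A r M) ^ n = (sub1 A r N) ^ n := by
  have hle : sub1 A r M ≤ sub1 A r N := Submodule.map_mono hMN
  generalize sub1 A r M = P at *
  generalize sub1 A r N = Q at *
  obtain ⟨k, rfl⟩ : ∃ k, ℓ = k + 1 := ⟨ℓ - 1, by omega⟩
  intro n hn
  induction n, hn using Nat.le_induction with
  | base => exact h
  | succ n hn ih =>
    obtain ⟨j, rfl⟩ : ∃ j, n = j + 1 := ⟨n - 1, by omega⟩
    apply le_antisymm
    · exact pow_le_pow_left' hle _
    · calc Q ^ (j + 1 + 1) = Q ^ (j + 1) * Q := pow_succ _ _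
        _ = P ^ (j + 1) * Q := by rw [ih]
        _ = P * (P ^ j * Q) := by rw [pow_succ', mul_assoc]
        _ ≤ P * (Q ^ j * Q) :=
          mul_le_mul' le_rfl (mul_le_mul' (pow_le_pow_left' hle j) le_rfl)
        _ = P * P ^ (j + 1) := by rw [← pow_succ, ih]
        _ = P ^ (j + 1 + 1) := (pow_succ' _ _).symm
end

section
/- Let (A, m) be a Noetherian local ring and M a finitely generated A-module contained in a free A-module F of finite rank r > 0. If the integral closure bar(M) equals F, then M = F. In particular, if M is a faithful A-module and M ≠ F, then tilde(M) ≠ F. -/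
set_option maxHeartbeats 1000000
set_option synthInstance.maxHeartbeats 400000

open MvPolynomial IsLocalRing

/-- A proper submodule of `A^r` is killed by a nonzero functional to a residue field. -/
lemma exists_functional (A : Type) [CommRing A] (r : ℕ) (M : Submodule A (Fin r → A))
    (hM : M ≠ ⊤) : ∃ I : Ideal A, I.IsMaximal ∧ ∃ φ : (Fin r → A) →ₗ[A] (A ⧸ I),
      φ ≠ 0 ∧ ∀ m ∈ M, φ m = 0 := by
  obtain ⟨N, hN, hMN⟩ := (eq_top_or_exists_le_coatom M).resolve_left hM
  have : IsSimpleModule A ((Fin r → A) ⧸ N) := isSimpleModule_iff_isCoatom.mpr hN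
  obtain ⟨I, hI, ⟨e⟩⟩ := isSimpleModule_iff_quot_maximal.mp this
  refine ⟨I, hI, e.toLinearMap ∘ₗ N.mkQ, ?_, ?_⟩
  · intro h
    apply hN.1
    rw [eq_top_iff]
    intro x _
    have := LinearMap.congr_fun h x
    simpa using this
  · intro m hm
    have := hMN hm
    simpa using this

lemma not_all_integral (A : Type) [CommRing A] (r : ℕ) (M : Submodule A (Fin r → A))
    (I : Ideal A) (hI : I.IsMaximal) (φ : (Fin r → A) →ₗ[A] (A ⧸ I)) (hφ : φ ≠ 0)
    (hφM : ∀ m ∈ M, φ m = 0) (D : Type) [CommRing D] [Algebra A D]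
    (π : MvPolynomial (Fin r) A →ₐ[A] D) (ψ : D →+* Polynomial (A ⧸ I))
    (hψ : ∀ a, ψ (algebraMap A D a) = Polynomial.C (Ideal.Quotient.mk I a))
    (hψX : ∀ i, ψ (π (X i)) = Polynomial.C (φ (Pi.single i 1)) * Polynomial.X)
    (hint : ∀ i, IsIntegral (Algebra.adjoin A (π '' (sub1 A r M : Set _))) (π (X i))) :
    False := by
  letI : Field (A ⧸ I) := Ideal.Quotient.field I
  have hemb : ∀ f : Fin r → A, ψ (π (emb A r f)) = Polynomial.C (φ f) * Polynomial.X := by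
    intro f
    have h1 : φ f = ∑ i, Ideal.Quotient.mk I (f i) * φ (Pi.single i 1) := by
      conv_lhs => rw [pi_eq_sum_univ' f]
      rw [map_sum]
      refine Finset.sum_congr rfl fun i _ => ?_
      rw [map_smul, Algebra.smul_def]
      rfl
    rw [h1, map_sum, Finset.sum_mul, Fintype.linearCombination_apply, map_sum, map_sum]
    refine Finset.sum_congr rfl fun i _ => ?_
    rw [map_smul, Algebra.smul_def, map_mul, hψ, hψX, map_mul, mul_assoc]
  obtain ⟨i, hi⟩ : ∃ i, φ (Pi.single i 1) ≠ 0 := by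
    by_contra! h
    apply hφ
    refine LinearMap.pi_ext' fun i => LinearMap.ext_ring ?_
    simpa using h i
  set R' := Algebra.adjoin A (π '' (sub1 A r M : Set _)) with hR'
  let h : R' →+* Polynomial (A ⧸ I) := ψ.comp R'.val.toRingHom
  let g : R' →+* (A ⧸ I) := Polynomial.constantCoeff.comp h
  have hg : h = Polynomial.C.comp g := by
    have key : ∀ x ∈ R', ψ x = Polynomial.C (Polynomial.constantCoeff (ψ x)) := by
      intro x hx
      induction hx using Algebra.adjoin_induction with
      | mem x hx =>
        obtain ⟨_, ⟨m, hm, rfl⟩, rfl⟩ := hx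
        rw [hemb, hφM m hm]
        simp
      | algebraMap a => rw [hψ]; simp
      | add x y _ _ hx hy => rw [map_add, map_add, map_add, ← hx, ← hy]
      | mul x y _ _ hx hy => rw [map_mul, map_mul, map_mul, ← hx, ← hy]
    ext1 x
    exact key x x.2
  have h1 : IsIntegral (A ⧸ I) (Polynomial.C (φ (Pi.single i 1)) * Polynomial.X) := by
    obtain ⟨p, hp, hpe⟩ := hint i
    refine ⟨p.map g, hp.map g, ?_⟩
    rw [Polynomial.eval₂_map, ← hψX]
    have : (algebraMap (A ⧸ I) (Polynomial (A ⧸ I))).comp g = h := hg.symm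
    rw [this]
    have := congrArg ψ hpe
    rw [Polynomial.hom_eval₂, map_zero] at this
    exact this
  have h2 : IsIntegral (A ⧸ I) (Polynomial.X : Polynomial (A ⧸ I)) := by
    have h3 := (isIntegral_algebraMap (R := A ⧸ I) (A := Polynomial (A ⧸ I))
      (x := (φ (Pi.single i 1))⁻¹)).mul h1
    rw [← mul_assoc, Polynomial.algebraMap_eq, ← map_mul, inv_mul_cancel₀ hi] at h3
    simpa using h3
  exact Polynomial.transcendental_X (A ⧸ I) h2.isAlgebraic

lemma X_mem_freeSub (A : Type) [CommRing A] (r : ℕ) (i : Fin r) :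
    (X i : MvPolynomial (Fin r) A) ∈ freeSub A r :=
  ⟨Pi.single i 1, trivial, by simp⟩

lemma part_one (A : Type) [CommRing A] (r : ℕ) (M : Submodule A (Fin r → A))
    (h : barPow A r M 1 = freeSub A r) : M = ⊤ := by
  by_contra hM
  obtain ⟨I, hI, φ, hφ, hφM⟩ := exists_functional A r M hM
  refine not_all_integral A r M I hI φ hφ hφM (MvPolynomial (Fin r) A) (AlgHom.id A _)
    (eval₂Hom (Polynomial.C.comp (Ideal.Quotient.mk I))
      fun i => Polynomial.C (φ (Pi.single i 1)) * Polynomial.X) ?_ ?_ ?_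
  · intro a
    simp [MvPolynomial.algebraMap_eq]
  · intro i
    simp
  · intro i
    have hx := X_mem_freeSub A r i
    rw [← h] at hx
    have h2 := hx.2
    rw [AlgHom.coe_id, Set.image_id]
    exact h2

lemma part_two (A : Type) [CommRing A] [IsLocalRing A] [IsNoetherianRing A]
    (r : ℕ) (M : Submodule A (Fin r → A)) (hf : faithfulSub A r M)
    (h : ratliffRush A r (freeSub A r) (sub1 A r M) = freeSub A r) : M = ⊤ := by
  by_contra hM
  obtain ⟨I, hI, φ, hφ, hφM⟩ := exists_functional A r M hM
  obtain ⟨p, hp⟩ := associatedPrimes.nonempty A A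
  obtain ⟨hpp, a, hpa⟩ := isAssociatedPrime_iff.mp hp
  have hpI : p ≤ I := by
    rw [IsLocalRing.eq_maximalIdeal hI]
    exact IsLocalRing.le_maximalIdeal hpp.ne_top
  let π : MvPolynomial (Fin r) A →ₐ[A] MvPolynomial (Fin r) (A ⧸ p) :=
    MvPolynomial.mapAlgHom (Ideal.Quotient.mkₐ A p)
  refine not_all_integral A r M I hI φ hφ hφM (MvPolynomial (Fin r) (A ⧸ p)) π
    (eval₂Hom (Polynomial.C.comp (Ideal.Quotient.factor hpI))
      fun i => Polynomial.C (φ (Pi.single i 1)) * Polynomial.X) ?_ ?_ ?_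
  · intro b
    rw [MvPolynomial.algebraMap_apply]
    simp [MvPolynomial.algebraMap_eq]
  · intro i
    simp [π]
  intro i
  -- an element of `M` that survives modulo `p`
  obtain ⟨m, hm, hm0⟩ : ∃ m ∈ M, π (emb A r m) ≠ 0 := by
    by_contra! hall
    have ha : a = 0 := by
      apply hf
      intro x hx
      have h0 := hall x hx
      ext j
      have hxj : x j ∈ p := by
        have h1 := congrArg (MvPolynomial.coeff (Finsupp.single j 1)) h0
        rw [Fintype.linearCombination_apply, map_sum] at h1
        simp only [π, map_smul, MvPolynomial.mapAlgHom_apply, MvPolynomial.map_X,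
          MvPolynomial.coeff_sum, MvPolynomial.coeff_smul, MvPolynomial.coeff_X,
          MvPolynomial.coeff_zero] at h1
        rw [Finset.sum_eq_single j] at h1
        · rw [if_pos rfl, Algebra.smul_def, mul_one] at h1
          exact Ideal.Quotient.eq_zero_iff_mem.mp h1
        · intro k _ hk
          rw [if_neg, smul_zero]
          intro hkj
          exact hk (Finsupp.single_left_injective one_ne_zero hkj)
        · simp
      rw [hpa] at hxj
      have : x j * a = 0 := by simpa using hxj
      simpa [mul_comm] using this
    apply hpp.ne_top
    rw [hpa, ha]
    rw [Ideal.eq_top_iff_one]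
    simp
  have hX := X_mem_freeSub A r i
  rw [← h, ratliffRush, Submodule.mem_iSup_of_directed] at hX
  swap
  · refine Monotone.directed_le (monotone_nat_of_le_succ fun n => ?_)
    refine inf_le_inf le_rfl ?_
    intro x hx
    rw [Submodule.mem_div_iff_forall_mul_mem] at hx ⊢
    intro y hy
    rw [pow_succ] at hy
    refine Submodule.mul_induction_on hy (fun u hu v hv => ?_) (fun u v hu hv => ?_)
    · rw [pow_succ, ← mul_assoc]
      exact Submodule.mul_mem_mul (hx u hu) hv
    · rw [mul_add]
      exact add_mem hu hv
  obtain ⟨l, -, hl⟩ := hX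
  rw [SetLike.mem_coe, Submodule.mem_div_iff_forall_mul_mem] at hl
  have hfg : (sub1 A r M ^ (l + 1)).FG :=
    Submodule.FG.pow ((IsNoetherian.noetherian M).map _) _
  obtain ⟨T, hT⟩ := hfg
  set R' := Algebra.adjoin A (π '' (sub1 A r M : Set _)) with hR'
  let N : Submodule R' (MvPolynomial (Fin r) (A ⧸ p)) := Submodule.span R' (π '' (T : Set _))
  have hN : ∀ y ∈ sub1 A r M ^ (l + 1), π y ∈ N := by
    intro y hy
    rw [← hT] at hy
    induction hy using Submodule.span_induction with
    | mem x hx => exact Submodule.subset_span ⟨x, hx, rfl⟩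
    | zero => rw [map_zero]; exact zero_mem _
    | add x y _ _ hx hy => rw [map_add]; exact add_mem hx hy
    | smul b x _ hx =>
      rw [map_smul]
      have := N.smul_mem (algebraMap A R' b) hx
      rwa [algebraMap_smul] at this
  refine isIntegral_of_smul_mem_submodule N ?_ ?_ _ ?_
  · intro hbot
    have h1 : π (emb A r m ^ (l + 1)) ∈ N :=
      hN _ (Submodule.pow_mem_pow _ (Submodule.mem_map_of_mem hm) _)
    rw [hbot, Submodule.mem_bot, map_pow] at h1
    exact hm0 (pow_eq_zero_iff (Nat.succ_ne_zero l) |>.mp h1)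
  · exact Submodule.fg_span (T.finite_toSet.image _)
  · intro n hn
    induction hn using Submodule.span_induction with
    | mem x hx =>
      obtain ⟨y, hy, rfl⟩ := hx
      have hy' : y ∈ sub1 A r M ^ (l + 1) := by
        rw [← hT]; exact Submodule.subset_span hy
      have h1 := hl y hy'
      rw [smul_eq_mul, ← map_mul]
      rw [show l + 2 = (l + 1) + 1 from rfl, pow_succ'] at h1
      refine Submodule.mul_induction_on h1 (fun u hu v hv => ?_) (fun u v hu hv => ?_)
      · rw [map_mul]
        exact N.smul_mem (⟨π u, Algebra.subset_adjoin ⟨u, hu, rfl⟩⟩ : R') (hN v hv)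
      · rw [map_add]
        exact add_mem hu hv
    | zero => rw [smul_zero]; exact zero_mem _
    | add x y _ _ hx hy => rw [smul_add]; exact add_mem hx hy
    | smul b x _ hx =>
      rw [smul_comm]
      exact N.smul_mem b hx

/-- Lemma 3.16. Let `(A, 𝔪)` be a Noetherian local ring and `M` a
finitely generated `A`-module contained in a free module `F` of finite rank `r > 0`.
If the integral closure `overline{M}` equals `F`, then `M = F`. In particular, if `M`
is a faithful `A`-module and `M ≠ F`, then `widetilde{M} ≠ F`. -/
theorem ratliffRush_statement_13 (A : Type) [CommRing A] [IsLocalRing A]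
    [IsNoetherianRing A]
    (r : ℕ) (hr : 0 < r) (M : Submodule A (Fin r → A)) :
    (barPow A r M 1 = freeSub A r → sub1 A r M = freeSub A r) ∧
    (faithfulSub A r M → M ≠ ⊤ →
      ratliffRush A r (freeSub A r) (sub1 A r M) ≠ freeSub A r) := by
  refine ⟨fun h => ?_, fun hf hM h => hM (part_two A r M hf h)⟩
  rw [part_one A r M h]
  rfl
end
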